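/- Let n ≥ 3 be an integer, let 0 < q < 1 and let x ∈ [0,1]. Then D_n^q(e_2)(x) − x² ≥ [2]_q x(1−x)(1−qⁿx)/[n−1]_q − ([2]_q [3]_q q^{n−1}/([n−1]_q [n−2]_q)) x(1−x)(1−qx)(1−qⁿx), and moreover D_n^q(e_2)(x) − x² ≥ 0. -/

import Mathlib

/-- The `q`-integer `[n]_q = 1 + q + ⋯ + q^{n-1}`. -/
noncomputable def qInt (q : ℝ) (n : ℕ) : ℝ := ∑ k ∈ Finset.range n, q ^ k

/-- The `q`-factorial `[n]_q!`. -/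
noncomputable def qFact (q : ℝ) (n : ℕ) : ℝ := ∏ k ∈ Finset.range n, qInt q (k + 1)

/-- The `q`-binomial coefficient `[m choose r]_q`. -/
noncomputable def qBinom (q : ℝ) (m r : ℕ) : ℝ := qFact q m / (qFact q r * qFact q (m - r))

/-- The Jackson `q`-integral of `g` over `[0,1]`. -/
noncomputable def qIntegral (q : ℝ) (g : ℝ → ℝ) : ℝ := (1 - q) * ∑' m : ℕ, q ^ m * g (q ^ m)

/-- The `q`-shifted factorial `(t;q)_n`. -/
noncomputable def qShift (q t : ℝ) (n : ℕ) : ℝ := ∏ j ∈ Finset.range n, (1 - t * q ^ j)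

/-- The `q`-beta function `B_q(m,n)`. -/
noncomputable def qBeta (q : ℝ) (m n : ℕ) : ℝ :=
  qIntegral q (fun t => t ^ (m - 1) * qShift q (q * t) (n - 1))

/-- The weight `m_{n,k,q}(x) = (x;q)_{n+1} [n+k choose k]_q x^k`. -/
noncomputable def mWeight (q : ℝ) (n k : ℕ) (x : ℝ) : ℝ :=
  qShift q x (n + 1) * qBinom q (n + k) k * x ^ k

/-- The `q`-MKZ–Durrmeyer operator. -/
noncomputable def Durr (q : ℝ) (n : ℕ) (f : ℝ → ℝ) (x : ℝ) : ℝ :=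
  if x = 1 then f 1
  else mWeight q n 0 x * f 0 +
    ∑' k : ℕ, mWeight q n (k + 1) x * (1 / qBeta q n (k + 1)) *
      qIntegral q (fun t => t ^ k * qShift q (q * t) (n - 1) * f t)

theorem HasSum.of_eq {f g : ℕ → ℝ} {a b : ℝ} (h : HasSum f a) (hfg : ∀ k, g k = f k)
    (hab : b = a) : HasSum g b := by
  rwa [funext hfg, hab]

theorem qInt_mul_one_sub (q : ℝ) (n : ℕ) : qInt q n * (1 - q) = 1 - q ^ n := by
  simpa [qInt] using geom_sum_mul_neg q n

theorem qInt_add (q : ℝ) (m n : ℕ) : qInt q (m + n) = qInt q m + q ^ m * qInt q n := by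
  simp [qInt, Finset.sum_range_add, Finset.mul_sum, pow_add]

theorem qInt_nonneg {q : ℝ} (hq : 0 < q) (n : ℕ) : 0 ≤ qInt q n :=
  Finset.sum_nonneg fun _ _ => by positivity

theorem one_le_qInt_succ {q : ℝ} (hq : 0 < q) (n : ℕ) : 1 ≤ qInt q (n + 1) := by
  rw [add_comm, qInt_add]
  have h : qInt q 1 = 1 := by simp [qInt]
  have := mul_nonneg hq.le (qInt_nonneg hq n)
  rw [h, pow_one]
  linarith

theorem qInt_succ_pos {q : ℝ} (hq : 0 < q) (n : ℕ) : 0 < qInt q (n + 1) :=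
  zero_lt_one.trans_le (one_le_qInt_succ hq n)

theorem qInt_mono {q : ℝ} (hq : 0 < q) {m n : ℕ} (h : m ≤ n) : qInt q m ≤ qInt q n := by
  obtain ⟨d, rfl⟩ := Nat.exists_eq_add_of_le h
  rw [qInt_add]
  exact le_add_of_nonneg_right (mul_nonneg (by positivity) (qInt_nonneg hq d))

theorem qInt_le {q : ℝ} (hq0 : 0 < q) (hq1 : q < 1) (n : ℕ) : qInt q n ≤ 1 / (1 - q) := by
  rw [le_div_iff₀ (by linarith), qInt_mul_one_sub]
  linarith [pow_pos hq0 n]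

theorem qFact_succ (q : ℝ) (n : ℕ) : qFact q (n + 1) = qFact q n * qInt q (n + 1) := by
  simp [qFact, Finset.prod_range_succ]

theorem qFact_pos {q : ℝ} (hq : 0 < q) (n : ℕ) : 0 < qFact q n :=
  Finset.prod_pos fun k _ => qInt_succ_pos hq k

theorem qBinom_add (q : ℝ) (n k : ℕ) :
    qBinom q (n + k) k = qFact q (n + k) / (qFact q k * qFact q n) := by
  simp [qBinom]

theorem qBinom_add_pos {q : ℝ} (hq : 0 < q) (n k : ℕ) : 0 < qBinom q (n + k) k := by
  rw [qBinom_add]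
  exact div_pos (qFact_pos hq _) (mul_pos (qFact_pos hq _) (qFact_pos hq _))

theorem qBinom_zero_right {q : ℝ} (hq : 0 < q) (n : ℕ) : qBinom q (n + 0) 0 = 1 := by
  rw [qBinom_add, add_zero]
  have := (qFact_pos hq n).ne'
  have h0 : qFact q 0 = 1 := by simp [qFact]
  rw [h0, one_mul, div_self this]

theorem qBinom_self {q : ℝ} (hq : 0 < q) (k : ℕ) : qBinom q (0 + k) k = 1 := by
  rw [qBinom_add, zero_add]
  have := (qFact_pos hq k).ne'
  have h0 : qFact q 0 = 1 := by simp [qFact]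
  rw [h0, mul_one, div_self this]

theorem qBinom_succ_left_mul {q : ℝ} (hq : 0 < q) (n k : ℕ) :
    qBinom q (n + 1 + k) k * qInt q (n + 1) = qBinom q (n + k) k * qInt q (n + 1 + k) := by
  have h1 := (qFact_pos hq k).ne'
  have h2 := (qFact_pos hq n).ne'
  have h3 := (qInt_succ_pos hq n).ne'
  rw [qBinom_add, qBinom_add, show n + 1 + k = n + k + 1 by ring, qFact_succ, qFact_succ q n]
  field_simp

theorem qBinom_succ_right_mul {q : ℝ} (hq : 0 < q) (n k : ℕ) :
    qBinom q (n + (k + 1)) (k + 1) * qInt q (k + 1) =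
      qBinom q (n + k) k * qInt q (n + k + 1) := by
  have h1 := (qFact_pos hq k).ne'
  have h2 := (qFact_pos hq n).ne'
  have h3 := (qInt_succ_pos hq k).ne'
  rw [qBinom_add, qBinom_add, ← add_assoc, qFact_succ, qFact_succ q k]
  field_simp

theorem qBinom_pascal {q : ℝ} (hq : 0 < q) (n k : ℕ) :
    qBinom q (n + 1 + (k + 1)) (k + 1) =
      qBinom q (n + (k + 1)) (k + 1) + q ^ (n + 1) * qBinom q (n + 1 + k) k := by
  have h1 := qBinom_succ_left_mul hq n (k + 1)
  have h2 := qBinom_succ_right_mul hq n k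
  have h3 := qBinom_succ_left_mul hq n k
  have h4 := (qInt_succ_pos hq n).ne'
  rw [qInt_add q (n + 1) (k + 1)] at h1
  rw [show n + k + 1 = n + 1 + k by ring] at h2
  apply mul_right_cancel₀ h4
  linear_combination h1 + q ^ (n + 1) * h2 - q ^ (n + 1) * h3

theorem qBinom_add_le {q : ℝ} (hq0 : 0 < q) (hq1 : q < 1) (n k : ℕ) :
    qBinom q (n + k) k ≤ (1 / (1 - q)) ^ n := by
  induction n with
  | zero => rw [qBinom_self hq0, pow_zero]
  | succ n ih =>
    calc qBinom q (n + 1 + k) k ≤ qBinom q (n + 1 + k) k * qInt q (n + 1) :=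
          le_mul_of_one_le_right (qBinom_add_pos hq0 _ _).le (one_le_qInt_succ hq0 n)
      _ = qBinom q (n + k) k * qInt q (n + 1 + k) := qBinom_succ_left_mul hq0 n k
      _ ≤ (1 / (1 - q)) ^ n * (1 / (1 - q)) :=
          mul_le_mul ih (qInt_le hq0 hq1 _) (qInt_nonneg hq0 _)
            ((qBinom_add_pos hq0 _ _).le.trans ih)
      _ = (1 / (1 - q)) ^ (n + 1) := (pow_succ _ _).symm

theorem qShift_succ (q t : ℝ) (n : ℕ) :
    qShift q t (n + 1) = qShift q t n * (1 - t * q ^ n) := by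
  simp [qShift, Finset.prod_range_succ]

theorem qShift_succ' (q t : ℝ) (n : ℕ) :
    qShift q t (n + 1) = (1 - t) * qShift q (q * t) n := by
  simp only [qShift, Finset.prod_range_succ', pow_zero, mul_one]
  rw [mul_comm]
  congr 1
  exact Finset.prod_congr rfl fun j _ => by ring

theorem one_sub_mul_pow_pos {q t : ℝ} (hq0 : 0 < q) (hq1 : q < 1) (ht0 : 0 ≤ t) (ht1 : t < 1)
    (j : ℕ) : 0 < 1 - t * q ^ j := by
  have := mul_le_of_le_one_right ht0 (pow_le_one₀ hq0.le hq1.le (n := j))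
  linarith

theorem qShift_pos {q t : ℝ} (hq0 : 0 < q) (hq1 : q < 1) (ht0 : 0 ≤ t) (ht1 : t < 1) (n : ℕ) :
    0 < qShift q t n :=
  Finset.prod_pos fun j _ => one_sub_mul_pow_pos hq0 hq1 ht0 ht1 j

theorem summable_qBinom_mul_pow {q x : ℝ} (hq0 : 0 < q) (hq1 : q < 1) (hx0 : 0 ≤ x)
    (hx1 : x < 1) (n : ℕ) : Summable fun k => qBinom q (n + k) k * x ^ k :=
  Summable.of_nonneg_of_le
    (fun k => mul_nonneg (qBinom_add_pos hq0 n k).le (pow_nonneg hx0 k))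
    (fun k => mul_le_mul_of_nonneg_right (qBinom_add_le hq0 hq1 n k) (pow_nonneg hx0 k))
    ((summable_geometric_of_lt_one hx0 hx1).mul_left _)

/-- The `q`-binomial series. -/
theorem hasSum_qBinom_mul_pow {q x : ℝ} (hq0 : 0 < q) (hq1 : q < 1) (hx0 : 0 ≤ x)
    (hx1 : x < 1) (n : ℕ) :
    HasSum (fun k => qBinom q (n + k) k * x ^ k) (1 / qShift q x (n + 1)) := by
  induction n with
  | zero =>
    simp only [qBinom_self hq0, one_mul]
    simpa [qShift] using hasSum_geometric_of_lt_one hx0 hx1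
  | succ n ih =>
    have hs := summable_qBinom_mul_pow hq0 hq1 hx0 hx1 (n + 1)
    have hp := one_sub_mul_pow_pos hq0 hq1 hx0 hx1 (n + 1)
    have hF := hs.tsum_eq_zero_add
    have hG := ih.summable.tsum_eq_zero_add
    have hG' := (summable_nat_add_iff 1).2 ih.summable
    have hshift : ∑' k, qBinom q (n + 1 + (k + 1)) (k + 1) * x ^ (k + 1) =
        ∑' k, qBinom q (n + (k + 1)) (k + 1) * x ^ (k + 1) +
          x * q ^ (n + 1) * ∑' k, qBinom q (n + 1 + k) k * x ^ k := by
      rw [← tsum_mul_left, ← hG'.tsum_add (hs.mul_left _)]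
      refine tsum_congr fun k => ?_
      rw [qBinom_pascal hq0]
      ring
    rw [hshift, qBinom_zero_right hq0] at hF
    rw [ih.tsum_eq, qBinom_zero_right hq0] at hG
    have := hs.hasSum
    convert this using 1
    rw [qShift_succ, one_div, mul_inv, ← div_eq_mul_inv, div_eq_iff hp.ne', ← one_div]
    linear_combination hG - hF

/-- The `q`-beta integral, as a convergent series. -/
theorem hasSum_qBeta {q : ℝ} (hq0 : 0 < q) (hq1 : q < 1) (a b : ℕ) :
    HasSum (fun m : ℕ => q ^ m * ((q ^ m) ^ a * qShift q (q * q ^ m) b))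
      (qFact q a * qFact q b / qFact q (a + b + 1) / (1 - q)) := by
  have h1q : (1 - q) ≠ 0 := by linarith
  induction b generalizing a with
  | zero =>
    have h := hasSum_geometric_of_lt_one (pow_nonneg hq0.le (a + 1))
      (pow_lt_one₀ hq0.le hq1 a.succ_ne_zero)
    have ha := (qInt_succ_pos hq0 a).ne'
    have hf := (qFact_pos hq0 a).ne'
    refine h.of_eq (fun m => ?_) ?_
    · simp only [qShift, Finset.range_zero, Finset.prod_empty]
      ring
    · rw [← qInt_mul_one_sub, add_zero, qFact_succ]
      simp only [qFact, Finset.range_zero, Finset.prod_empty] at hf ⊢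
      field_simp
  | succ b ih =>
    have h := (ih a).sub ((ih (a + 1)).mul_left (q ^ (b + 1)))
    have h1 := (qFact_pos hq0 (a + b + 1)).ne'
    have h2 := (qInt_succ_pos hq0 (a + b + 1)).ne'
    have h3 : qInt q (a + b + 1 + 1) = qInt q (b + 1) + q ^ (b + 1) * qInt q (a + 1) := by
      rw [← qInt_add]
      congr 1
      ring
    refine h.of_eq (fun m => ?_) ?_
    · rw [qShift_succ]
      ring
    · rw [show a + (b + 1) + 1 = a + b + 1 + 1 by ring,
        show a + 1 + b + 1 = a + b + 1 + 1 by ring, qFact_succ q (a + b + 1), qFact_succ q a,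
        qFact_succ q b]
      field_simp
      linear_combination -(qFact q a * qFact q b) * h3

theorem qIntegral_pow_mul_qShift {q : ℝ} (hq0 : 0 < q) (hq1 : q < 1) (a b : ℕ) :
    qIntegral q (fun t => t ^ a * qShift q (q * t) b) =
      qFact q a * qFact q b / qFact q (a + b + 1) := by
  have h1q : (1 - q) ≠ 0 := by linarith
  rw [qIntegral, (hasSum_qBeta hq0 hq1 a b).tsum_eq]
  field_simp

theorem mWeight_nonneg {q x : ℝ} (hq0 : 0 < q) (hq1 : q < 1) (hx0 : 0 ≤ x) (hx1 : x < 1)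
    (n k : ℕ) : 0 ≤ mWeight q n k x :=
  mul_nonneg (mul_nonneg (qShift_pos hq0 hq1 hx0 hx1 _).le (qBinom_add_pos hq0 n k).le)
    (pow_nonneg hx0 k)

theorem mWeight_succ_left_mul {q : ℝ} (hq : 0 < q) (x : ℝ) (n k : ℕ) :
    mWeight q (n + 1) k x * qInt q (n + 1) =
      (1 - q ^ (n + 1) * x) * mWeight q n k x * qInt q (n + 1 + k) := by
  have h := qBinom_succ_left_mul hq n k
  rw [mWeight, mWeight, qShift_succ q x (n + 1)]
  linear_combination (qShift q x (n + 1) * (1 - x * q ^ (n + 1)) * x ^ k) * h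

theorem mWeight_succ_right_mul {q : ℝ} (hq : 0 < q) (x : ℝ) (n k : ℕ) :
    mWeight q n (k + 1) x * qInt q (k + 1) = x * mWeight q n k x * qInt q (n + k + 1) := by
  have h := qBinom_succ_right_mul hq n k
  rw [mWeight, mWeight]
  linear_combination (qShift q x (n + 1) * x ^ (k + 1)) * h

theorem hasSum_mWeight_mul_pow {q x : ℝ} (hq0 : 0 < q) (hq1 : q < 1) (hx0 : 0 ≤ x)
    (hx1 : x < 1) (n j : ℕ) :
    HasSum (fun k => mWeight q n k x * (q ^ j) ^ k)
      (qShift q x (n + 1) / qShift q (q ^ j * x) (n + 1)) := by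
  have hj : q ^ j * x < 1 :=
    (mul_le_of_le_one_left hx0 (pow_le_one₀ hq0.le hq1.le)).trans_lt hx1
  have h := (hasSum_qBinom_mul_pow hq0 hq1 (mul_nonneg (pow_nonneg hq0.le j) hx0) hj n).mul_left
    (qShift q x (n + 1))
  refine h.of_eq (fun k => ?_) ?_
  · rw [mWeight]
    ring
  · ring

theorem hasSum_mWeight {q x : ℝ} (hq0 : 0 < q) (hq1 : q < 1) (hx0 : 0 ≤ x)
    (hx1 : x < 1) (n : ℕ) : HasSum (fun k => mWeight q n k x) 1 := by
  have h := hasSum_mWeight_mul_pow hq0 hq1 hx0 hx1 n 0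
  simpa [div_self (qShift_pos hq0 hq1 hx0 hx1 (n + 1)).ne'] using h

theorem hasSum_mWeight_mul_pow_one {q x : ℝ} (hq0 : 0 < q) (hq1 : q < 1) (hx0 : 0 ≤ x)
    (hx1 : x < 1) (n : ℕ) :
    HasSum (fun k => (1 - q ^ (n + 1) * x) * (mWeight q n k x * q ^ k)) (1 - x) := by
  have h := (hasSum_mWeight_mul_pow hq0 hq1 hx0 hx1 n 1).mul_left (1 - q ^ (n + 1) * x)
  have hqx : q * x < 1 := (mul_le_of_le_one_left hx0 hq1.le).trans_lt hx1
  have hp := (qShift_pos hq0 hq1 (mul_nonneg hq0.le hx0) hqx (n + 1)).ne'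
  rw [pow_one] at h
  refine h.of_eq (fun _ => rfl) ?_
  rw [mul_div_assoc', eq_div_iff hp]
  linear_combination qShift_succ q x (n + 1) - qShift_succ' q x (n + 1)

theorem hasSum_mWeight_mul_pow_two {q x : ℝ} (hq0 : 0 < q) (hq1 : q < 1) (hx0 : 0 ≤ x)
    (hx1 : x < 1) (n : ℕ) :
    HasSum (fun k => (1 - q ^ (n + 2) * x) * (1 - q ^ (n + 1) * x) *
      (mWeight q n k x * (q ^ 2) ^ k)) ((1 - x) * (1 - q * x)) := by
  have h := (hasSum_mWeight_mul_pow hq0 hq1 hx0 hx1 n 2).mul_left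
    ((1 - q ^ (n + 2) * x) * (1 - q ^ (n + 1) * x))
  have hqx : q ^ 2 * x < 1 :=
    (mul_le_of_le_one_left hx0 (pow_le_one₀ hq0.le hq1.le)).trans_lt hx1
  have hp := (qShift_pos hq0 hq1 (mul_nonneg (pow_nonneg hq0.le 2) hx0) hqx (n + 1)).ne'
  refine h.of_eq (fun _ => rfl) ?_
  rw [mul_div_assoc', eq_div_iff hp]
  have h1 := qShift_succ q x (n + 2)
  rw [qShift_succ' q x (n + 2), qShift_succ' q (q * x) (n + 1), qShift_succ q x (n + 1),
    show q * (q * x) = q ^ 2 * x by ring] at h1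
  linear_combination h1

theorem hasSum_mWeight_mul_ratio {q x : ℝ} (hq0 : 0 < q) (hq1 : q < 1) (hx0 : 0 ≤ x)
    (hx1 : x < 1) (n : ℕ) :
    HasSum (fun k => mWeight q n k x * (qInt q k / qInt q (n + k))) x := by
  rw [← hasSum_nat_add_iff' 1]
  refine ((hasSum_mWeight hq0 hq1 hx0 hx1 n).mul_left x).of_eq (fun k => ?_) ?_
  · have h := mWeight_succ_right_mul hq0 x n k
    have := (qInt_succ_pos hq0 (n + k)).ne'
    rw [← add_assoc, mul_div_assoc', h]
    field_simp
  · simp [qInt]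

theorem Durr_sq_eq {q x : ℝ} (hq0 : 0 < q) (hq1 : q < 1) (hx1 : x ≠ 1) (n : ℕ) :
    Durr q (n + 1) (fun t => t ^ 2) x =
      x * ∑' k, mWeight q (n + 1) k x * (qInt q (k + 2) / qInt q (n + 1 + k + 2)) := by
  rw [Durr, if_neg hx1, ← tsum_mul_left]
  simp only [ne_eq, OfNat.ofNat_ne_zero, not_false_eq_true, zero_pow, mul_zero, zero_add]
  refine tsum_congr fun k => ?_
  have h1 := qIntegral_pow_mul_qShift hq0 hq1 n k
  have h2 := qIntegral_pow_mul_qShift hq0 hq1 (k + 2) n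
  have h3 : (fun t : ℝ => t ^ k * qShift q (q * t) (n + 1 - 1) * t ^ 2) =
      fun t => t ^ (k + 2) * qShift q (q * t) n := by
    funext t
    rw [Nat.add_sub_cancel]
    ring
  have h4 := mWeight_succ_right_mul hq0 x (n + 1) k
  have p1 := (qFact_pos hq0 n).ne'
  have p2 := (qFact_pos hq0 k).ne'
  have p3 := (qFact_pos hq0 (n + k + 1)).ne'
  have p4 := (qInt_succ_pos hq0 (n + k + 1)).ne'
  have p5 := (qInt_succ_pos hq0 (n + k + 1 + 1)).ne'
  rw [qBeta, Nat.add_sub_cancel, Nat.add_sub_cancel, h1]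
  rw [Nat.add_sub_cancel] at h3
  rw [h3, h2, show k + 2 + n + 1 = n + k + 1 + 1 + 1 by ring, qFact_succ q (n + k + 1 + 1), qFact_succ q (n + k + 1),
    show k + 2 = k + 1 + 1 by ring, qFact_succ q (k + 1), qFact_succ q k,
    show n + 1 + k + 2 = n + k + 1 + 1 + 1 by ring]
  rw [show n + 1 + k + 1 = n + k + 1 + 1 by ring] at h4
  field_simp
  linear_combination qInt q (k + 1 + 1) * h4

theorem qInt_ratio_sub {q : ℝ} (hq : 0 < q) (n k : ℕ) :
    qInt q (k + 2) / qInt q (n + 1 + k + 2) = qInt q k / qInt q (n + 1 + k) +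
      qInt q 2 * q ^ k * qInt q (n + 1) / (qInt q (n + 1 + k) * qInt q (n + 1 + k + 2)) := by
  have p1 : qInt q (n + 1 + k) ≠ 0 := by
    rw [add_right_comm]; exact (qInt_succ_pos hq (n + k)).ne'
  have p2 : qInt q (n + 1 + k + 2) ≠ 0 := (qInt_succ_pos hq _).ne'
  field_simp
  rw [qInt_add q k 2, qInt_add q (n + 1 + k) 2, add_comm (n + 1) k, qInt_add q k (n + 1), pow_add]
  have e := qInt_mul_one_sub q (n + 1)
  have e' := qInt_mul_one_sub q k
  linear_combination (-(qInt q k * q ^ k * qInt q 2)) * e + (q ^ k * qInt q 2 * qInt q (n + 1)) * e'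

theorem one_div_qInt_lower {q : ℝ} (hq : 0 < q) (m : ℕ) :
    1 / qInt q (m + 2) - qInt q 3 * q ^ (m + 2) / (qInt q (m + 2) * qInt q (m + 1)) ≤
      1 / qInt q (m + 5) := by
  have p1 := qInt_succ_pos hq m
  have p2 := qInt_succ_pos hq (m + 1)
  have p5 := qInt_succ_pos hq (m + 4)
  have hm := qInt_mono hq (show m + 1 ≤ m + 5 by omega)
  have h3 := qInt_succ_pos hq 2
  have e : 1 / qInt q (m + 5) = 1 / qInt q (m + 2) -
      qInt q 3 * q ^ (m + 2) / (qInt q (m + 2) * qInt q (m + 5)) := by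
    have h := qInt_add q (m + 2) 3
    have n2 : qInt q (m + 2) ≠ 0 := p2.ne'
    have n5 : qInt q (m + 5) ≠ 0 := p5.ne'
    field_simp
    linear_combination -h
  rw [e]
  have : 0 < qInt q 3 := h3
  have : 0 < qInt q (m + 2) := p2
  gcongr

theorem stmt6 (q : ℝ) (hq0 : 0 < q) (hq1 : q < 1) (n : ℕ) (hn : 3 ≤ n)
    (x : ℝ) (hx : x ∈ Set.Icc (0 : ℝ) 1) :
    qInt q 2 * x * (1 - x) * (1 - q ^ n * x) / qInt q (n - 1) -
        (qInt q 2 * qInt q 3 * q ^ (n - 1) / (qInt q (n - 1) * qInt q (n - 2))) *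
          (x * (1 - x) * (1 - q * x) * (1 - q ^ n * x)) ≤
      Durr q n (fun t => t ^ 2) x - x ^ 2 ∧
    0 ≤ Durr q n (fun t => t ^ 2) x - x ^ 2 := by
  obtain ⟨hx0, hx1⟩ := hx
  rcases hx1.eq_or_lt with rfl | hx1
  · simp [Durr]
  obtain ⟨p, rfl⟩ := Nat.exists_eq_add_of_le' hn
  rw [Durr_sq_eq hq0 hq1 hx1.ne (p + 2), show p + 3 - 1 = p + 2 by omega,
    show p + 3 - 2 = p + 1 by omega]
  have hw := hasSum_mWeight hq0 hq1 hx0 hx1 (p + 2 + 1)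
  have hw0 := mWeight_nonneg hq0 hq1 hx0 hx1
  have hr := hasSum_mWeight_mul_ratio hq0 hq1 hx0 hx1 (p + 2 + 1)
  have hS : Summable fun k => mWeight q (p + 2 + 1) k x *
      (qInt q (k + 2) / qInt q (p + 2 + 1 + k + 2)) := by
    refine Summable.of_nonneg_of_le
      (fun k => mul_nonneg (hw0 _ k) (div_nonneg (qInt_nonneg hq0 _) (qInt_nonneg hq0 _)))
      (fun k => mul_le_of_le_one_right (hw0 _ k) (div_le_one_of_le₀ ?_ (qInt_nonneg hq0 _)))
      hw.summable
    exact qInt_mono hq0 (by omega)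
  have hb0 : 0 < 1 - q ^ (p + 3) * x := by
    simpa [mul_comm] using one_sub_mul_pow_pos hq0 hq1 hx0 hx1 (p + 3)
  have c1 : 0 < qInt q (p + 1) := qInt_succ_pos hq0 _
  have c2 : 0 < qInt q (p + 2) := qInt_succ_pos hq0 _
  have c3 : 0 < qInt q 2 := qInt_succ_pos hq0 _
  constructor
  · have hA := (hasSum_mWeight_mul_pow_one hq0 hq1 hx0 hx1 (p + 1)).mul_left
      (qInt q 2 * (1 - q ^ (p + 3) * x) / qInt q (p + 2))
    have hB := (hasSum_mWeight_mul_pow_two hq0 hq1 hx0 hx1 p).mul_left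
      (qInt q 2 * (1 - q ^ (p + 3) * x) * qInt q 3 * q ^ (p + 2) /
        (qInt q (p + 2) * qInt q (p + 1)))
    have key := hasSum_le (fun k => ?_) ((hr.add hA).sub hB) hS.hasSum
    · have := mul_le_mul_of_nonneg_left key hx0
      refine le_trans (le_of_eq ?_) (sub_le_sub_right this _)
      ring
    · have l3 := mWeight_succ_left_mul hq0 x (p + 2) k
      have l2 := mWeight_succ_left_mul hq0 x (p + 1) k
      have l1 := mWeight_succ_left_mul hq0 x p k
      have lo := one_div_qInt_lower hq0 (p + k)
      rw [qInt_ratio_sub hq0 (p + 2) k, mul_add]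
      rw [show p + 2 + 1 + k = p + k + 3 by ring] at l3 ⊢
      rw [show p + 1 + 1 + k = p + k + 2 by ring, show p + 1 + 1 = p + 2 by ring] at l2
      rw [show p + 1 + k = p + k + 1 by ring] at l1
      have d1 : qInt q (p + k + 1) ≠ 0 := (qInt_succ_pos hq0 _).ne'
      have d2 : qInt q (p + k + 2) ≠ 0 := (qInt_succ_pos hq0 _).ne'
      have d3 : qInt q (p + k + 3) ≠ 0 := (qInt_succ_pos hq0 _).ne'
      have d5 : qInt q (p + k + 3 + 2) ≠ 0 := (qInt_succ_pos hq0 _).ne'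
      have hmain := mul_le_mul_of_nonneg_left lo
        (mul_nonneg (mul_nonneg (mul_nonneg c3.le hb0.le) (hw0 (p + 2) k)) (pow_nonneg hq0.le k))
      have e1 : mWeight q (p + 2 + 1) k x * (qInt q 2 * q ^ k * qInt q (p + 2 + 1) /
            (qInt q (p + k + 3) * qInt q (p + k + 3 + 2))) =
          qInt q 2 * (1 - q ^ (p + 3) * x) * mWeight q (p + 2) k x * q ^ k *
            (1 / qInt q (p + k + 5)) := by
        have d5' : qInt q (p + k + 5) ≠ 0 := d5
        rw [show p + k + 3 + 2 = p + k + 5 by ring]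
        field_simp
        linear_combination l3
      have e2 : mWeight q (p + 2) k x * (1 / qInt q (p + k + 2)) =
          (1 - q ^ (p + 2) * x) * mWeight q (p + 1) k x / qInt q (p + 2) := by
        field_simp
        linear_combination l2
      have e3 : mWeight q (p + 1) k x * (1 / qInt q (p + k + 1)) =
          (1 - q ^ (p + 1) * x) * mWeight q p k x / qInt q (p + 1) := by
        field_simp
        linear_combination l1
      rw [e1, add_sub_assoc]
      refine add_le_add_right (le_trans (le_of_eq ?_) hmain) _
      have e4 : mWeight q (p + 2) k x * (1 / qInt q (p + k + 2)) * (1 / qInt q (p + k + 1)) =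
          (1 - q ^ (p + 2) * x) * ((1 - q ^ (p + 1) * x) * mWeight q p k x / qInt q (p + 1)) /
            qInt q (p + 2) := by
        rw [e2, ← e3]
        ring
      rw [show p + 1 + 1 = p + 2 by ring]
      linear_combination (-(qInt q 2 * (1 - q ^ (p + 3) * x) * q ^ k)) * e2 +
        (qInt q 2 * (1 - q ^ (p + 3) * x) * q ^ k * qInt q 3 * q ^ (p + k + 2)) * e4
  · have key := hasSum_le (fun k => ?_) hr hS.hasSum
    · have := mul_le_mul_of_nonneg_left key hx0
      linear_combination this
    · refine mul_le_mul_of_nonneg_left ?_ (hw0 _ k)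
      rw [qInt_ratio_sub hq0 (p + 2) k]
      refine le_add_of_nonneg_right (div_nonneg (mul_nonneg (mul_nonneg c3.le ?_) ?_)
        (mul_nonneg ?_ ?_))
      · positivity
      all_goals exact qInt_nonneg hq0 _
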